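/- Let m ≥ 1 and let e₁,…,e_m, f₁,…,f_m ∈ R satisfy: (i) for all indices j, k with |j−k| ≥ 2, each of e_j, f_j commutes with each of e_k, f_k; and (ii') f_{j+1}·e_j = q·(e_j·f_{j+1}) for 1 ≤ j ≤ m−1. Then P_m(e_m+f_m, e_{m−1}+f_{m−1}, …, e_1+f_1) = Σ_{l=0}^{m} P_m(e_m, e_{m−1}, …, e_{l+1}, f_l, f_{l−1}, …, f_1), where the l-th summand has arguments e_m, e_{m−1}, …, e_{l+1} followed by f_l, f_{l−1}, …, f_1. -/

import Mathlib

noncomputable section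

/-- The `t`-commutator `[a,b]_t = a*b - t•(b*a)`. -/
def qcomm {R : Type*} [Ring R] [Algebra ℂ R] (t : ℂ) (a b : R) : R :=
  a * b - t • (b * a)

/-- Left-nested iterated `q`-commutator:
`P (y₁,…,y_k) = [ … [[y₁,y₂]_q, y₃]_q …, y_k]_q`. -/
def PL {R : Type*} [Ring R] [Algebra ℂ R] (q : ℂ) : List R → R
  | [] => 1
  | y :: ys => ys.foldl (fun a b => qcomm q a b) y

section qcomm

variable {R : Type*} [Ring R] [Algebra ℂ R]

theorem qcomm_add_right (t : ℂ) (a b c : R) :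
    qcomm t a (b + c) = qcomm t a b + qcomm t a c := by
  simp only [qcomm, mul_add, add_mul, smul_add]
  abel

theorem qcomm_sum_left {ι : Type*} (t : ℂ) (s : Finset ι) (g : ι → R) (b : R) :
    qcomm t (∑ i ∈ s, g i) b = ∑ i ∈ s, qcomm t (g i) b := by
  simp only [qcomm, Finset.sum_mul, Finset.mul_sum, Finset.smul_sum, Finset.sum_sub_distrib]

theorem Commute.qcomm_left {t : ℂ} {a b c : R} (ha : Commute a c) (hb : Commute b c) :
    Commute (qcomm t a b) c :=
  (ha.mul_left hb).sub_left ((hb.mul_left ha).smul_left t)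

theorem qcomm_eq_zero {t : ℂ} {a b : R} (h : a * b = t • (b * a)) : qcomm t a b = 0 := by
  rw [qcomm, h, sub_self]

theorem qcomm_qcomm_eq_zero {t : ℂ} {x a b : R} (hx : Commute x b)
    (h : a * b = t • (b * a)) : qcomm t (qcomm t x a) b = 0 := by
  have h₁ : x * a * b = t • (b * (x * a)) := by
    rw [mul_assoc, h, mul_smul_comm, ← mul_assoc, ← mul_assoc, hx.eq]
  have h₂ : a * x * b = t • (b * (a * x)) := by
    rw [mul_assoc, hx.eq, ← mul_assoc, h, smul_mul_assoc, mul_assoc]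
  simp only [qcomm, sub_mul, mul_sub, smul_mul_assoc, mul_smul_comm, smul_sub, h₁, h₂, sub_self]

theorem PL_append_singleton (q : ℂ) {l : List R} (hl : l ≠ []) (x : R) :
    PL q (l ++ [x]) = qcomm q (PL q l) x := by
  cases l with
  | nil => exact absurd rfl hl
  | cons y ys => simp [PL]

theorem PL_commute (q : ℂ) (x : R) (l : List R) (h : ∀ y ∈ l, Commute y x) :
    Commute (PL q l) x := by
  induction l using List.reverseRecOn with
  | nil => exact Commute.one_left x
  | append_singleton l y ih =>
    rcases eq_or_ne l [] with rfl | hl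
    · exact h y (by simp)
    · rw [PL_append_singleton q hl]
      exact (ih fun z hz => h z (by simp [hz])).qcomm_left (h y (by simp))

theorem PL_map_range_succ (q : ℂ) (y : ℕ → R) {n : ℕ} (hn : n ≠ 0) :
    PL q ((List.range (n + 1)).map y) = qcomm q (PL q ((List.range n).map y)) (y n) := by
  rw [List.range_succ, List.map_append, List.map_singleton,
    PL_append_singleton q (by simpa using hn)]

theorem PL_map_range_congr (q : ℂ) {y z : ℕ → R} {n : ℕ} (h : ∀ i < n, y i = z i) :
    PL q ((List.range n).map y) = PL q ((List.range n).map z) := by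
  congr 1
  exact List.map_congr_left fun i hi => h i (List.mem_range.mp hi)

/-- Appending `x` to a left-nested `q`-commutator gives zero if `x` commutes with all arguments but
the last and has vanishing `q`-commutator with the last one. -/
theorem qcomm_PL_map_range_eq_zero {q : ℂ} {y : ℕ → R} {n : ℕ} {x : R}
    (hfar : ∀ i < n, Commute (y i) x) (h : y n * x = q • (x * y n)) :
    qcomm q (PL q ((List.range (n + 1)).map y)) x = 0 := by
  rcases eq_or_ne n 0 with rfl | hn
  · exact qcomm_eq_zero h
  · rw [PL_map_range_succ q y hn]
    refine qcomm_qcomm_eq_zero (PL_commute q x _ fun z hz => ?_) h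
    obtain ⟨i, hi, rfl⟩ := List.mem_map.mp hz
    exact hfar i (List.mem_range.mp hi)

theorem PL_map_range_add (q : ℂ) (a b : ℕ → R)
    (haa : ∀ i j, i + 1 < j → Commute (a i) (a j))
    (hba : ∀ i j, i + 1 < j → Commute (b i) (a j))
    (h : ∀ i, b i * a (i + 1) = q • (a (i + 1) * b i)) (n : ℕ) :
    PL q ((List.range (n + 1)).map fun i => a i + b i) =
      ∑ k ∈ Finset.range (n + 2),
        PL q ((List.range (n + 1)).map fun i => if i < k then a i else b i) := by
  induction n with
  | zero => simp [PL, Finset.sum_range_succ, add_comm]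
  | succ n ih =>
    have hsucc (k : ℕ) := PL_map_range_succ q (fun i => if i < k then a i else b i) n.succ_ne_zero
    have hvanish : ∀ k ∈ Finset.range (n + 1),
        qcomm q (PL q ((List.range (n + 1)).map fun i => if i < k then a i else b i))
          (a (n + 1)) = 0 := by
      intro k hk
      rw [Finset.mem_range] at hk
      apply qcomm_PL_map_range_eq_zero
      · intro i hi
        split_ifs
        · exact haa i _ (by omega)
        · exact hba i _ (by omega)
      · simpa [show ¬ n < k by omega] using h n
    have hlast :
        PL q ((List.range (n + 1)).map fun i => if i < n + 1 then a i else b i) =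
          PL q ((List.range (n + 1)).map fun i => if i < n + 2 then a i else b i) :=
      PL_map_range_congr q fun i hi => by simp [hi, show i < n + 2 by omega]
    rw [PL_map_range_succ q _ n.succ_ne_zero, ih, qcomm_add_right, qcomm_sum_left, qcomm_sum_left,
      Finset.sum_range_succ, Finset.sum_eq_zero hvanish, zero_add, Finset.sum_range_succ _ (n + 2),
      add_comm]
    congr 1
    · refine Finset.sum_congr rfl fun k hk => ?_
      rw [Finset.mem_range] at hk
      rw [hsucc, if_neg (by omega)]
    · rw [hsucc, if_pos (by omega), hlast]

theorem ofFn_eq_map_range {α : Type*} {n : ℕ} {g : Fin n → α} {y : ℕ → α}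
    (h : ∀ j : Fin n, g j = y j) : List.ofFn g = (List.range n).map y := by
  apply List.ext_getElem <;> simp [h]

end qcomm

/-- Dual descending-terms expansion:
`P_m(e_m+f_m, …, e_1+f_1) = Σ_{l=0}^{m} P_m(e_m,…,e_{l+1}, f_l,…,f_1)`.
Here `Fin.rev j` encodes the reversal of the order of the arguments. -/
theorem PL_sum_descending_dual {R : Type*} [Ring R] [Algebra ℂ R]
    (q : ℂ) (hq : q ≠ 0) (m : ℕ) (hm : 1 ≤ m) (e f : Fin m → R)
    (hfar : ∀ j l : Fin m, (j : ℕ) + 1 < (l : ℕ) →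
      e j * e l = e l * e j ∧ e j * f l = f l * e j ∧
      f j * e l = e l * f j ∧ f j * f l = f l * f j)
    (hfe : ∀ j l : Fin m, (l : ℕ) = (j : ℕ) + 1 → f l * e j = q • (e j * f l)) :
    PL q (List.ofFn fun j : Fin m => e j.rev + f j.rev) =
      ∑ l ∈ Finset.range (m + 1),
        PL q (List.ofFn fun j : Fin m =>
          if (j : ℕ) < m - l then e j.rev else f j.rev) := by
  let a : ℕ → R := fun i => if h : i < m then e (Fin.rev ⟨i, h⟩) else 0
  let b : ℕ → R := fun i => if h : i < m then f (Fin.rev ⟨i, h⟩) else 0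
  have ha (j : Fin m) : a j = e j.rev := by simp [a]
  have hb (j : Fin m) : b j = f j.rev := by simp [b]
  have haa (i j : ℕ) (hij : i + 1 < j) : Commute (a i) (a j) := by
    by_cases hj : j < m
    · have := (hfar (Fin.rev ⟨j, hj⟩) (Fin.rev ⟨i, by omega⟩) (by simp; omega)).1
      simpa [a, hj, show i < m by omega, commute_iff_eq] using this.symm
    · simp [a, hj]
  have hba (i j : ℕ) (hij : i + 1 < j) : Commute (b i) (a j) := by
    by_cases hj : j < m
    · have := (hfar (Fin.rev ⟨j, hj⟩) (Fin.rev ⟨i, by omega⟩) (by simp; omega)).2.1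
      simpa [a, b, hj, show i < m by omega, commute_iff_eq] using this.symm
    · simp [a, hj]
  have hadj (i : ℕ) : b i * a (i + 1) = q • (a (i + 1) * b i) := by
    by_cases hi : i + 1 < m
    · have := hfe (Fin.rev ⟨i + 1, hi⟩) (Fin.rev ⟨i, by omega⟩) (by simp; omega)
      simpa [a, b, hi, show i < m by omega] using this
    · simp [a, hi]
  have key := PL_map_range_add q a b haa hba hadj (m - 1)
  rw [show m - 1 + 2 = m + 1 by omega, Nat.sub_add_cancel hm] at key
  rw [ofFn_eq_map_range (y := fun i => a i + b i) fun j => by rw [ha, hb], key,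
    ← Finset.sum_range_reflect]
  refine Finset.sum_congr rfl fun l _ => ?_
  rw [ofFn_eq_map_range (y := fun i => if i < m - l then a i else b i) fun j => by rw [ha, hb],
    Nat.add_sub_cancel]
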